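/- Define K₂(t,ρ) = ∫_ρ^∞ e^{(3/4)t} K₃(t,s) sinh(s) (cosh s - cosh ρ)^{-1/2} ds for t > 0 and ρ > 0, where K₃(t,s) = (4πt)^{-3/2} (s/sinh s) e^{-t - s²/(4t)}. Then for every t > 0 and every ρ > 0, K₂(t,ρ) · (∂²_ρ K₂(t,ρ) - coth(ρ) ∂_ρ K₂(t,ρ)) > (∂_ρ K₂(t,ρ))², where ∂_ρ, ∂²_ρ denote the first and second ordinary derivatives in ρ. -/

import Mathlib

open Real MeasureTheory

/-- The heat kernel of 3-dimensional hyperbolic space. -/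
noncomputable def K₃ (t s : ℝ) : ℝ :=
  (4 * π * t) ^ (-(3 : ℝ) / 2) * (s / Real.sinh s) * Real.exp (-t - s ^ 2 / (4 * t))

/-- The heat kernel of 2-dimensional hyperbolic space, defined from `K₃` via the
Davies–Mandouvalos integral recurrence. -/
noncomputable def K₂ (t ρ : ℝ) : ℝ :=
  ∫ s in Set.Ioi ρ,
    Real.exp ((3 / 4) * t) * K₃ t s * Real.sinh s *
      (Real.cosh s - Real.cosh ρ) ^ (-(1 : ℝ) / 2)


noncomputable def hkG (t s : ℝ) : ℝ := s / sinh s * exp (-(s ^ 2 / (4 * t)))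
noncomputable def hkH (t s : ℝ) : ℝ := (1 / s - cosh s / sinh s - s / (2 * t)) / sinh s
noncomputable def hkK (t s : ℝ) : ℝ :=
  (-1 / s ^ 2 + 1 / sinh s ^ 2 - 1 / (2 * t)) / sinh s ^ 2 - hkH t s * (cosh s / sinh s) / sinh s
noncomputable def hkG1 (t s : ℝ) : ℝ := hkG t s * hkH t s
noncomputable def hkG2 (t s : ℝ) : ℝ := hkG t s * (hkH t s ^ 2 + hkK t s)

lemma hk_pos_of_deriv {f f' : ℝ → ℝ} (hf : ∀ x, HasDerivAt f (f' x) x) (h0 : f 0 = 0)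
    (hp : ∀ x, 0 < x → 0 < f' x) : ∀ x, 0 < x → 0 < f x := by
  intro x hx
  have hm : StrictMonoOn f (Set.Ici 0) := by
    apply strictMonoOn_of_deriv_pos (convex_Ici 0)
    · exact fun y _ => (hf y).continuousAt.continuousWithinAt
    · intro y hy
      rw [interior_Ici] at hy
      rw [(hf y).deriv]
      exact hp y hy
  have := hm (Set.mem_Ici.2 le_rfl) (Set.mem_Ici.2 hx.le) hx
  rwa [h0] at this

lemma hk_aux0 : ∀ w : ℝ, 0 < w → 0 < w * cosh w - sinh w := by
  apply hk_pos_of_deriv (f' := fun w => w * sinh w)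
  · intro x
    have := ((hasDerivAt_id x).mul (hasDerivAt_cosh x)).sub (hasDerivAt_sinh x)
    convert! this using 1
    simp
  · simp
  · intro x hx
    have := sinh_pos_iff.2 hx
    positivity

lemma hk_aux1 : ∀ w : ℝ, 0 < w → 0 < 2 * w * sinh w + w ^ 2 * cosh w + 6 - 6 * cosh w := by
  apply hk_pos_of_deriv (f' := fun w => w ^ 2 * sinh w + 4 * (w * cosh w - sinh w))
  · intro x
    have := ((((((hasDerivAt_id x).const_mul 2).mul (hasDerivAt_sinh x))).add
      ((hasDerivAt_pow 2 x).mul (hasDerivAt_cosh x))).add_const 6).sub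
      ((hasDerivAt_cosh x).const_mul 6)
    convert! this using 1
    simp
    ring
  · simp
  · intro x hx
    have := sinh_pos_iff.2 hx
    have := hk_aux0 x hx
    positivity

lemma hk_aux2 : ∀ w : ℝ, 0 < w → 0 < w ^ 2 * sinh w + 6 * w - 6 * sinh w := by
  apply hk_pos_of_deriv (f' := fun w => 2 * w * sinh w + w ^ 2 * cosh w + 6 - 6 * cosh w)
  · intro x
    have := (((hasDerivAt_pow 2 x).mul (hasDerivAt_sinh x)).add
      ((hasDerivAt_id x).const_mul 6)).sub ((hasDerivAt_sinh x).const_mul 6)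
    convert! this using 1
    simp
  · simp
  · exact hk_aux1

lemma hk_aux3 : ∀ w : ℝ, 0 < w →
    0 < w ^ 2 * cosh w + 3 * w ^ 2 - 2 * w * sinh w - 4 * cosh w + 4 := by
  apply hk_pos_of_deriv (f' := fun w => w ^ 2 * sinh w + 6 * w - 6 * sinh w)
  · intro x
    have := (((((hasDerivAt_pow 2 x).mul (hasDerivAt_cosh x)).add
      ((hasDerivAt_pow 2 x).const_mul 3)).sub
      (((hasDerivAt_id x).const_mul 2).mul (hasDerivAt_sinh x))).sub
      ((hasDerivAt_cosh x).const_mul 4)).add_const 4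
    convert! this using 1
    simp
    ring
  · simp
  · exact hk_aux2

lemma hk_q_pos (s : ℝ) (hs : 0 < s) :
    0 < s ^ 2 * sinh s ^ 2 + 2 * s ^ 2 - s * cosh s * sinh s - sinh s ^ 2 := by
  have h := hk_aux3 (2 * s) (by positivity)
  rw [cosh_two_mul, sinh_two_mul, cosh_sq] at h
  nlinarith

lemma hkK_pos (t s : ℝ) (ht : 0 < t) (hs : 0 < s) : 0 < hkK t s := by
  have h1 := hk_q_pos s hs
  have h2 := hk_aux0 s hs
  have h3 := sinh_pos_iff.2 hs
  have : hkK t s = (s ^ 2 * sinh s ^ 2 + 2 * s ^ 2 - s * cosh s * sinh s - sinh s ^ 2)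
      / (s ^ 2 * sinh s ^ 4) + (s * cosh s - sinh s) / (2 * t * sinh s ^ 3) := by
    unfold hkK hkH
    field_simp
    have := cosh_sq s
    ring_nf
    simp only [this]
    ring
  rw [this]
  positivity

lemma hkG_pos (t s : ℝ) (hs : 0 < s) : 0 < hkG t s := by
  have h3 := sinh_pos_iff.2 hs
  unfold hkG
  positivity

lemma hkG_deriv (t s : ℝ) (ht : 0 < t) (hs : 0 < s) :
    HasDerivAt (hkG t) (hkG1 t s * sinh s) s := by
  have h3 := sinh_pos_iff.2 hs
  have := ((hasDerivAt_id s).div (hasDerivAt_sinh s) h3.ne').mul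
    (((hasDerivAt_pow 2 s).div_const (4 * t)).neg.exp)
  convert! this using 1
  simp only [hkG1, hkG, hkH, id, Pi.div_apply, Pi.neg_apply]
  field_simp
  ring

lemma hkH_deriv (t s : ℝ) (ht : 0 < t) (hs : 0 < s) :
    HasDerivAt (hkH t) (hkK t s * sinh s) s := by
  have h3 := sinh_pos_iff.2 hs
  have := ((((hasDerivAt_inv hs.ne').sub
    ((hasDerivAt_cosh s).div (hasDerivAt_sinh s) h3.ne')).sub
    ((hasDerivAt_id s).div_const (2 * t))).div (hasDerivAt_sinh s) h3.ne')
  convert! this using 1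
  · funext x; simp [hkH]
  simp only [hkK, hkH, id, Pi.div_apply, Pi.sub_apply]
  have := cosh_sq s
  field_simp
  ring_nf
  simp only [this]
  ring

lemma hkG1_deriv (t s : ℝ) (ht : 0 < t) (hs : 0 < s) :
    HasDerivAt (hkG1 t) (hkG2 t s * sinh s) s := by
  have := (hkG_deriv t s ht hs).mul (hkH_deriv t s ht hs)
  convert! this using 1
  simp only [hkG1, hkG2]
  ring

/-- Boundedness on `[a, ∞)`. -/
def HkB (a : ℝ) (f : ℝ → ℝ) : Prop := ∃ C, ∀ s, a ≤ s → |f s| ≤ C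

lemma HkB.add {a : ℝ} {f g : ℝ → ℝ} (hf : HkB a f) (hg : HkB a g) :
    HkB a (fun s => f s + g s) := by
  obtain ⟨C, hC⟩ := hf
  obtain ⟨D, hD⟩ := hg
  exact ⟨C + D, fun s hs => (abs_add_le _ _).trans (add_le_add (hC s hs) (hD s hs))⟩

lemma HkB.mul {a : ℝ} {f g : ℝ → ℝ} (hf : HkB a f) (hg : HkB a g) :
    HkB a (fun s => f s * g s) := by
  obtain ⟨C, hC⟩ := hf
  obtain ⟨D, hD⟩ := hg
  refine ⟨C * D, fun s hs => ?_⟩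
  rw [abs_mul]
  exact mul_le_mul (hC s hs) (hD s hs) (abs_nonneg _) ((abs_nonneg _).trans (hC s hs))

lemma HkB.const {a : ℝ} (c : ℝ) : HkB a (fun _ => c) := ⟨|c|, fun _ _ => le_rfl⟩

lemma HkB.congr {a : ℝ} {f g : ℝ → ℝ} (hf : HkB a f) (h : ∀ s, a ≤ s → g s = f s) : HkB a g := by
  obtain ⟨C, hC⟩ := hf
  exact ⟨C, fun s hs => by rw [h s hs]; exact hC s hs⟩

section
variable {a : ℝ}

lemma hkB_inv (ha : 0 < a) : HkB a (fun s => 1 / s) := by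
  refine ⟨1 / a, fun s hs => ?_⟩
  have : 0 < s := ha.trans_le hs
  beta_reduce
  rw [abs_of_pos (by positivity)]
  gcongr

lemma hkB_invsinh (ha : 0 < a) : HkB a (fun s => 1 / sinh s) := by
  refine ⟨1 / sinh a, fun s hs => ?_⟩
  have h0 := sinh_pos_iff.2 ha
  have h1 := sinh_le_sinh.2 hs
  beta_reduce
  rw [abs_of_pos (by have := h0.trans_le h1; positivity)]
  gcongr

lemma hkB_coth (ha : 0 < a) : HkB a (fun s => cosh s / sinh s) := by
  obtain ⟨C, hC⟩ := hkB_invsinh ha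
  refine ⟨1 + C, fun s hs => ?_⟩
  have h1 := sinh_pos_iff.2 (ha.trans_le hs)
  have h2 := hC s hs
  have h3 := cosh_pos s
  rw [abs_of_pos (by positivity)] at h2 ⊢
  have h4 : cosh s ≤ sinh s + 1 := by
    have := exp_le_one_iff.2 (by linarith : -s ≤ 0)
    rw [← cosh_sub_sinh] at this
    linarith
  calc cosh s / sinh s ≤ (sinh s + 1) / sinh s := by gcongr
    _ = 1 + 1 / sinh s := by field_simp
    _ ≤ _ := by linarith

lemma hkB_s (ha : 0 < a) : HkB a (fun s => s / sinh s) := by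
  refine ⟨1, fun s hs => ?_⟩
  have h0 := ha.trans_le hs
  have h1 := sinh_pos_iff.2 h0
  rw [abs_of_pos (by positivity), div_le_one h1]
  exact self_le_sinh_iff.2 h0.le

lemma hkB_gauss (t : ℝ) (ht : 0 < t) (ha : 0 < a) :
    HkB a (fun s => s * exp (-(s ^ 2 / (4 * t)))) := by
  refine ⟨t + 1, fun s hs => ?_⟩
  beta_reduce
  have h0 := ha.trans_le hs
  rw [abs_of_pos (by positivity), exp_neg, ← div_eq_mul_inv, div_le_iff₀ (exp_pos _)]
  have h1 := add_one_le_exp (s ^ 2 / (4 * t))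
  have h2 : s ≤ t + s ^ 2 / (4 * t) := by
    have : t + s ^ 2 / (4 * t) - s = (s - 2 * t) ^ 2 / (4 * t) := by field_simp; ring
    have : 0 ≤ (s - 2 * t) ^ 2 / (4 * t) := by positivity
    linarith
  have h3 : 0 ≤ s ^ 2 / (4 * t) := by positivity
  nlinarith

lemma hkB_G (t : ℝ) (ht : 0 < t) (ha : 0 < a) : HkB a (fun s => hkG t s * cosh s) :=
  ((hkB_gauss t ht ha).mul (hkB_coth ha)).congr fun s _ => by unfold hkG; ring

lemma hkB_H (t : ℝ) (ha : 0 < a) : HkB a (hkH t) :=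
  ((((hkB_inv ha).add ((hkB_coth ha).mul (HkB.const (-1)))).mul (hkB_invsinh ha)).add
    ((hkB_s ha).mul (HkB.const (-1 / (2 * t))))).congr fun s _ => by unfold hkH; ring

lemma hkB_K (t : ℝ) (ha : 0 < a) : HkB a (hkK t) :=
  ((((((hkB_inv ha).mul (hkB_inv ha)).mul (HkB.const (-1))).add
    ((hkB_invsinh ha).mul (hkB_invsinh ha))).add (HkB.const (-1 / (2 * t)))).mul
    ((hkB_invsinh ha).mul (hkB_invsinh ha))).add
    (((hkB_H t ha).mul ((hkB_coth ha).mul (hkB_invsinh ha))).mul (HkB.const (-1))) |>.congr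
    fun s _ => by unfold hkK; ring

lemma hkB_G1 (t : ℝ) (ht : 0 < t) (ha : 0 < a) : HkB a (fun s => hkG1 t s * cosh s) :=
  ((hkB_G t ht ha).mul (hkB_H t ha)).congr fun s _ => by unfold hkG1; ring

lemma hkB_G2 (t : ℝ) (ht : 0 < t) (ha : 0 < a) : HkB a (fun s => hkG2 t s * cosh s) :=
  ((hkB_G t ht ha).mul (((hkB_H t ha).mul (hkB_H t ha)).add (hkB_K t ha))).congr
    fun s _ => by unfold hkG2; ring

end

lemma hk_weight_int : IntegrableOn (fun u : ℝ => (1 + u)⁻¹ * u ^ (-(1 : ℝ) / 2)) (Set.Ioi 0) := by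
  have hm : ∀ s : Set ℝ, AEStronglyMeasurable (fun u : ℝ => (1 + u)⁻¹ * u ^ (-(1 : ℝ) / 2))
      (volume.restrict s) := fun s => by
    apply Measurable.aestronglyMeasurable
    fun_prop
  rw [← Set.Ioc_union_Ioi_eq_Ioi (zero_le_one' ℝ)]
  apply IntegrableOn.union
  · have h : IntegrableOn (fun u : ℝ => u ^ (-(1 : ℝ) / 2)) (Set.Ioc 0 1) := by
      rw [← intervalIntegrable_iff_integrableOn_Ioc_of_le zero_le_one]
      exact intervalIntegral.intervalIntegrable_rpow' (by norm_num)
    refine Integrable.mono h (hm _) ?_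
    refine (ae_restrict_mem measurableSet_Ioc).mono fun u hu => ?_
    have hu0 : 0 < u := hu.1
    rw [norm_mul, norm_of_nonneg (by positivity : 0 ≤ (1 + u)⁻¹)]
    exact mul_le_of_le_one_left (norm_nonneg _) (inv_le_one_of_one_le₀ (by linarith))
  · have h : IntegrableOn (fun u : ℝ => u ^ (-(3 : ℝ) / 2)) (Set.Ioi 1) :=
      integrableOn_Ioi_rpow_of_lt (by norm_num) one_pos
    refine Integrable.mono h (hm _) ?_
    refine (ae_restrict_mem measurableSet_Ioi).mono fun u hu => ?_
    have hu0 : 0 < u := one_pos.trans hu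
    rw [norm_of_nonneg (by positivity), norm_of_nonneg (by positivity)]
    have : u ^ (-(3 : ℝ) / 2) = u⁻¹ * u ^ (-(1 : ℝ) / 2) := by
      rw [← rpow_neg_one u, ← rpow_add hu0]
      norm_num
    rw [this]
    gcongr
    linarith

/-- The hypotheses on profiles: continuity on `(1, ∞)` and decay `O(1/y)` away from `1`. -/
def HkP (f : ℝ → ℝ) : Prop :=
  ContinuousOn f (Set.Ioi 1) ∧ ∀ a, 1 < a → ∃ C, ∀ y, a ≤ y → |f y| ≤ C / y

lemma hkP_meas {f : ℝ → ℝ} (hf : HkP f) {x : ℝ} (hx : 1 < x) :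
    AEStronglyMeasurable (fun u : ℝ => f (x + u) * u ^ (-(1 : ℝ) / 2))
      (volume.restrict (Set.Ioi 0)) := by
  apply AEStronglyMeasurable.mul
  · refine ContinuousOn.aestronglyMeasurable ?_ measurableSet_Ioi
    refine hf.1.comp (by fun_prop) fun u hu => ?_
    have : 0 < u := hu
    show 1 < x + u
    linarith
  · apply Measurable.aestronglyMeasurable
    fun_prop

lemma hkP_bound {f : ℝ → ℝ} (hf : HkP f) {a : ℝ} (ha : 1 < a) :
    ∃ C, ∀ u, 0 < u → ∀ x, a ≤ x →
      ‖f (x + u) * u ^ (-(1 : ℝ) / 2)‖ ≤ C * ((1 + u)⁻¹ * u ^ (-(1 : ℝ) / 2)) := by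
  obtain ⟨C, hC⟩ := hf.2 a ha
  refine ⟨C, fun u hu x hx => ?_⟩
  have h1 := hC (x + u) (by linarith)
  have hC0 : 0 ≤ C := by
    have h2 := (abs_nonneg _).trans h1
    by_contra h
    exact absurd h2 (not_le.2 (div_neg_of_neg_of_pos (not_le.1 h) (by linarith)))
  rw [norm_mul, norm_of_nonneg (by positivity : 0 ≤ u ^ (-(1 : ℝ) / 2)), ← mul_assoc,
    ← div_eq_mul_inv, norm_eq_abs]
  gcongr
  refine h1.trans ?_
  gcongr
  linarith

lemma hkP_int {f : ℝ → ℝ} (hf : HkP f) {x : ℝ} (hx : 1 < x) :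
    IntegrableOn (fun u : ℝ => f (x + u) * u ^ (-(1 : ℝ) / 2)) (Set.Ioi 0) := by
  obtain ⟨C, hC⟩ := hkP_bound hf hx
  refine Integrable.mono' (hk_weight_int.const_mul C) (hkP_meas hf hx) ?_
  exact (ae_restrict_mem measurableSet_Ioi).mono fun u hu => hC u hu x le_rfl

noncomputable def hkI (f : ℝ → ℝ) (x : ℝ) : ℝ :=
  ∫ u in Set.Ioi (0 : ℝ), f (x + u) * u ^ (-(1 : ℝ) / 2)

lemma hkI_deriv {f f' : ℝ → ℝ} (hf : HkP f) (hf' : HkP f')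
    (hd : ∀ y, 1 < y → HasDerivAt f (f' y) y) {x : ℝ} (hx : 1 < x) :
    HasDerivAt (hkI f) (hkI f' x) x := by
  obtain ⟨a, ha1, hax⟩ := exists_between hx
  obtain ⟨C, hC⟩ := hkP_bound hf' ha1
  refine (hasDerivAt_integral_of_dominated_loc_of_deriv_le
    (μ := volume.restrict (Set.Ioi 0)) (F := fun x u => f (x + u) * u ^ (-(1 : ℝ) / 2))
    (F' := fun x u => f' (x + u) * u ^ (-(1 : ℝ) / 2)) (s := Set.Ioi a)
    (bound := fun u => C * ((1 + u)⁻¹ * u ^ (-(1 : ℝ) / 2)))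
    (Ioi_mem_nhds hax) ?_ (hkP_int hf hx) (hkP_meas hf' hx) ?_ (hk_weight_int.const_mul C) ?_).2
  · filter_upwards [Ioi_mem_nhds hx] with y hy using hkP_meas hf hy
  · exact (ae_restrict_mem measurableSet_Ioi).mono fun u hu y hy => hC u hu y (le_of_lt hy)
  · refine (ae_restrict_mem measurableSet_Ioi).mono fun u hu y hy => ?_
    have h0 : 0 < u := hu
    have h1 : a < y := hy
    exact ((hd (y + u) (by linarith)).comp_add_const y u).mul_const _

lemma hkP_of {φ φ' : ℝ → ℝ} (hd : ∀ s, 0 < s → HasDerivAt φ (φ' s) s)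
    (hb : ∀ a, 0 < a → HkB a (fun s => φ s * cosh s)) : HkP (fun y => φ (arcosh y)) := by
  constructor
  · intro y hy
    exact ((hd _ (arcosh_pos hy)).continuousAt.comp
      (hasDerivAt_arcosh hy).continuousAt).continuousWithinAt
  · intro a ha
    obtain ⟨C, hC⟩ := hb (arcosh a) (arcosh_pos ha)
    refine ⟨C, fun y hy => ?_⟩
    have h0 : 0 < y := by linarith
    have := hC (arcosh y) ((arcosh_le_arcosh (by linarith) (by linarith)).2 hy)
    beta_reduce at this ⊢
    rw [cosh_arcosh (by linarith : 1 ≤ y), abs_mul, abs_of_pos h0] at this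
    rwa [le_div_iff₀ h0]

lemma hk_comp_deriv {φ φ' : ℝ → ℝ} (hd : ∀ s, 0 < s → HasDerivAt φ (φ' s * sinh s) s)
    (y : ℝ) (hy : 1 < y) : HasDerivAt (fun y => φ (arcosh y)) (φ' (arcosh y)) y := by
  have := (hd _ (arcosh_pos hy)).comp y (hasDerivAt_arcosh hy)
  convert! this using 1
  have h := sinh_pos_iff.2 (arcosh_pos hy)
  rw [← sinh_arcosh hy.le]
  field_simp

lemma hkG2_diff (t s : ℝ) (ht : 0 < t) (hs : 0 < s) : DifferentiableAt ℝ (hkG2 t) s := by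
  have h3 := (sinh_pos_iff.2 hs).ne'
  have hH := (hkH_deriv t s ht hs).differentiableAt
  have hG := (hkG_deriv t s ht hs).differentiableAt
  have hK : DifferentiableAt ℝ (hkK t) s := by
    unfold hkK
    have h4 : s ^ 2 ≠ 0 := by positivity
    have h5 : sinh s ^ 2 ≠ 0 := by positivity
    fun_prop (disch := assumption)
  unfold hkG2
  fun_prop

lemma hkI_pos {f : ℝ → ℝ} (hf : HkP f) (hp : ∀ y, 1 < y → 0 < f y) {x : ℝ} (hx : 1 < x) :
    0 < hkI f x := by
  have h : ∀ u ∈ Set.Ioi (0 : ℝ), 0 < f (x + u) * u ^ (-(1 : ℝ) / 2) := fun u hu => by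
    have h0 : 0 < u := hu
    exact mul_pos (hp _ (by linarith)) (rpow_pos_of_pos h0 _)
  unfold hkI
  rw [setIntegral_pos_iff_support_of_nonneg_ae
    ((ae_restrict_mem measurableSet_Ioi).mono fun u hu => (h u hu).le) (hkP_int hf hx)]
  rw [Set.inter_eq_right.2 (fun u hu => Function.mem_support.2 (h u hu).ne')]
  simp

lemma hkP_quad {f g k : ℝ → ℝ} (hf : HkP f) (hg : HkP g) (hk : HkP k) (l : ℝ) :
    HkP (fun y => k y + 2 * l * g y + l ^ 2 * f y) := by
  refine ⟨(hk.1.add (hg.1.const_mul (2 * l))).add (hf.1.const_mul (l ^ 2)) , fun a ha => ?_⟩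
  obtain ⟨A, hA⟩ := hf.2 a ha
  obtain ⟨B, hB⟩ := hg.2 a ha
  obtain ⟨D, hD⟩ := hk.2 a ha
  refine ⟨D + |2 * l| * B + |l ^ 2| * A, fun y hy => ?_⟩
  calc |k y + 2 * l * g y + l ^ 2 * f y| ≤ |k y| + |2 * l * g y| + |l ^ 2 * f y| := abs_add_three _ _ _
    _ = |k y| + |2 * l| * |g y| + |l ^ 2| * |f y| := by rw [abs_mul _ (g y), abs_mul _ (f y)]
    _ ≤ D / y + |2 * l| * (B / y) + |l ^ 2| * (A / y) := by
      gcongr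
      exacts [hD y hy, hB y hy, hA y hy]
    _ = _ := by ring

lemma hkI_quad {f g k : ℝ → ℝ} (hf : HkP f) (hg : HkP g) (hk : HkP k)
    (hp : ∀ y, 1 < y → 0 < f y) (hc : ∀ y, 1 < y → g y ^ 2 < f y * k y) {x : ℝ} (hx : 1 < x) :
    hkI g x ^ 2 < hkI f x * hkI k x := by
  have hF := hkI_pos hf hp hx
  have key : ∀ l : ℝ, 0 < hkI k x + 2 * l * hkI g x + l ^ 2 * hkI f x := by
    intro l
    have h1 := hkI_pos (hkP_quad hf hg hk l) (fun y hy => by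
      have hfy := hp y hy
      have := hc y hy
      have h2 : 0 < f y * (k y + 2 * l * g y + l ^ 2 * f y) := by
        nlinarith [sq_nonneg (l * f y + g y)]
      exact pos_of_mul_pos_right h2 hfy.le) hx
    have h2 : hkI (fun y => k y + 2 * l * g y + l ^ 2 * f y) x
        = hkI k x + 2 * l * hkI g x + l ^ 2 * hkI f x := by
      unfold hkI
      rw [← integral_const_mul, ← integral_const_mul, ← integral_add, ← integral_add]
      · congr 1; funext u; ring
      · exact (hkP_int hk hx).add ((hkP_int hg hx).const_mul _)
      · exact (hkP_int hf hx).const_mul _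
      · exact hkP_int hk hx
      · exact (hkP_int hg hx).const_mul _
    rwa [h2] at h1
  have h := mul_pos hF (key (-(hkI g x / hkI f x)))
  have e : hkI f x * (hkI k x + 2 * (-(hkI g x / hkI f x)) * hkI g x
      + (-(hkI g x / hkI f x)) ^ 2 * hkI f x) = hkI f x * hkI k x - hkI g x ^ 2 := by
    field_simp
    ring
  rw [e] at h
  linarith

noncomputable def hkC (t : ℝ) : ℝ := exp ((3 / 4) * t) * (4 * π * t) ^ (-(3 : ℝ) / 2) * exp (-t)

lemma hk_K₂_eq (t ρ : ℝ) (hρ : 0 < ρ) :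
    K₂ t ρ = hkC t * hkI (fun y => hkG t (arcosh y)) (cosh ρ) := by
  have him : (fun s => cosh s - cosh ρ) '' Set.Ioi ρ = Set.Ioi 0 := by
    ext u
    constructor
    · rintro ⟨s, hs, rfl⟩
      have : cosh ρ < cosh s := by
        rw [cosh_lt_cosh, abs_of_pos hρ, abs_of_pos (hρ.trans hs)]; exact hs
      exact sub_pos.2 this
    · intro hu
      have hu0 : 0 < u := hu
      have h1 := one_le_cosh ρ
      refine ⟨arcosh (cosh ρ + u), ?_, ?_⟩
      · show ρ < _
        conv_lhs => rw [← arcosh_cosh hρ.le]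
        rw [arcosh_lt_arcosh] <;> linarith
      · show cosh (arcosh _) - _ = _
        rw [cosh_arcosh (by linarith)]; ring
  have hinj : Set.InjOn (fun s => cosh s - cosh ρ) (Set.Ioi ρ) := by
    intro a ha b hb hab
    have h : cosh a = cosh b := by simpa using hab
    rw [← arcosh_cosh (hρ.trans ha).le, ← arcosh_cosh (hρ.trans hb).le, h]
  unfold hkI
  rw [← him, integral_image_eq_integral_abs_deriv_smul measurableSet_Ioi
    (fun s _ => ((hasDerivAt_cosh s).sub_const _).hasDerivWithinAt) hinj, ← integral_const_mul]
  unfold K₂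
  refine setIntegral_congr_fun measurableSet_Ioi fun s hs => ?_
  have h0 : 0 < s := hρ.trans hs
  have h1 := sinh_pos_iff.2 h0
  simp only [smul_eq_mul, add_sub_cancel, arcosh_cosh h0.le, abs_of_pos h1, K₃, hkC, hkG]
  rw [sub_eq_add_neg (-t), exp_add]
  ring

theorem stmt_18 (t : ℝ) (ht : 0 < t) (ρ : ℝ) (hρ : 0 < ρ) :
    (deriv (fun r => K₂ t r) ρ) ^ 2 <
      K₂ t ρ *
        (deriv (deriv (fun r => K₂ t r)) ρ -
          (Real.cosh ρ / Real.sinh ρ) * deriv (fun r => K₂ t r) ρ) := by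
  have P0 : HkP (fun y => hkG t (arcosh y)) :=
    hkP_of (fun s hs => hkG_deriv t s ht hs) (fun a ha => hkB_G t ht ha)
  have P1 : HkP (fun y => hkG1 t (arcosh y)) :=
    hkP_of (fun s hs => hkG1_deriv t s ht hs) (fun a ha => hkB_G1 t ht ha)
  have P2 : HkP (fun y => hkG2 t (arcosh y)) :=
    hkP_of (fun s hs => (hkG2_diff t s ht hs).hasDerivAt) (fun a ha => hkB_G2 t ht ha)
  have hch : ∀ r : ℝ, 0 < r → 1 < cosh r := fun r hr => one_lt_cosh.2 hr.ne'
  have hC : 0 < hkC t := by unfold hkC; positivity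
  have D0 : ∀ r, 0 < r → HasDerivAt (fun r => K₂ t r)
      (hkC t * (hkI (fun y => hkG1 t (arcosh y)) (cosh r) * sinh r)) r := by
    intro r hr
    have h := ((hkI_deriv P0 P1 (hk_comp_deriv fun s hs => hkG_deriv t s ht hs)
      (hch r hr)).comp r (hasDerivAt_cosh r)).const_mul (hkC t)
    refine h.congr_of_eventuallyEq ?_
    filter_upwards [Ioi_mem_nhds hr] with x hx using hk_K₂_eq t x hx
  have D1 : HasDerivAt (deriv (fun r => K₂ t r))
      (hkC t * (hkI (fun y => hkG2 t (arcosh y)) (cosh ρ) * sinh ρ * sinh ρ +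
        hkI (fun y => hkG1 t (arcosh y)) (cosh ρ) * cosh ρ)) ρ := by
    have h := ((((hkI_deriv P1 P2 (hk_comp_deriv fun s hs => hkG1_deriv t s ht hs)
      (hch ρ hρ)).comp ρ (hasDerivAt_cosh ρ)).mul (hasDerivAt_sinh ρ)).const_mul (hkC t))
    refine h.congr_of_eventuallyEq ?_
    filter_upwards [Ioi_mem_nhds hρ] with x hx using (D0 x hx).deriv
  have Q := hkI_quad P0 P1 P2 (fun y hy => hkG_pos t _ (arcosh_pos hy)) (fun y hy => by
    have h1 := hkG_pos t _ (arcosh_pos hy)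
    have h2 := hkK_pos t _ ht (arcosh_pos hy)
    have h3 : 0 < hkG t (arcosh y) ^ 2 * hkK t (arcosh y) := by positivity
    simp only [hkG1, hkG2]
    nlinarith) (hch ρ hρ)
  rw [D1.deriv, (D0 ρ hρ).deriv, hk_K₂_eq t ρ hρ]
  have hs := sinh_pos_iff.2 hρ
  generalize hkI (fun y => hkG t (arcosh y)) (cosh ρ) = A at *
  generalize hkI (fun y => hkG1 t (arcosh y)) (cosh ρ) = B at *
  generalize hkI (fun y => hkG2 t (arcosh y)) (cosh ρ) = D at *
  have e : hkC t * A * (hkC t * (D * sinh ρ * sinh ρ + B * cosh ρ)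
      - cosh ρ / sinh ρ * (hkC t * (B * sinh ρ))) = (hkC t * sinh ρ) ^ 2 * (A * D) := by
    field_simp
    ring
  rw [e]
  calc (hkC t * (B * sinh ρ)) ^ 2 = (hkC t * sinh ρ) ^ 2 * B ^ 2 := by ring
    _ < _ := by gcongr
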